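/- arXiv:2102.13586 — 2 statements merged into one kernel-verified Lean document; each statement's English description precedes it below -/
import Mathlib

section
/- Let d ≥ 1 and R > 0. There exists a constant C > 0 such that for every non-negative integer k, every pair of exponents 1 ≤ p ≤ q ≤ ∞, every λ > 0, and every Schwartz function u : ℝ^d → ℂ whose Fourier transform is supported in the closed ball of radius λR centered at the origin, one has ‖∇^k u‖_{L^q} ≤ C^{k+1} · λ^{k + d(1/p − 1/q)} · ‖u‖_{L^p}. -/
open MeasureTheory SchwartzMap Real
open scoped ENNReal FourierTransform

section Lp

variable {α : Type*} [MeasurableSpace α]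

/-- Jensen's inequality for the power `p ≥ 1`, with respect to a weight `g`. -/
theorem lintegral_mul_le_rpow_mul_rpow {μ : Measure α} {g f : α → ℝ≥0∞} (hg : AEMeasurable g μ)
    (hf : Measurable f) {p : ℝ} (hp : 1 ≤ p) :
    ∫⁻ a, g a * f a ∂μ ≤
      (∫⁻ a, g a * f a ^ p ∂μ) ^ (1 / p) * (∫⁻ a, g a ∂μ) ^ (1 - 1 / p) := by
  have h := eLpNorm'_le_eLpNorm'_mul_rpow_measure_univ (μ := μ.withDensity g) (f := f)
    zero_lt_one hp hf.aestronglyMeasurable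
  simp only [eLpNorm', enorm_eq_self, ENNReal.rpow_one, div_one, withDensity_apply _ .univ,
    Measure.restrict_univ] at h
  rwa [lintegral_withDensity_eq_lintegral_mul₀ hg hf.aemeasurable,
    lintegral_withDensity_eq_lintegral_mul₀ hg (hf.pow_const p).aemeasurable] at h

/-- Interpolation between `L^p` and `L^∞`. -/
theorem eLpNorm_le_rpow_mul_eLpNorm_rpow {μ : Measure α} {F : Type*} [NormedAddCommGroup F]
    {f : α → F} (hfm : AEStronglyMeasurable f μ) {S : ℝ≥0∞} (hf : ∀ x, ‖f x‖ₑ ≤ S)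
    {p q : ℝ≥0∞} (hp : p ≠ 0) (hpq : p ≤ q) (hq : q ≠ ∞) :
    eLpNorm f q μ ≤ S ^ (1 - p.toReal / q.toReal) * eLpNorm f p μ ^ (p.toReal / q.toReal) := by
  have hp' : p ≠ ∞ := ne_top_of_le_ne_top hq hpq
  have hq0 : q ≠ 0 := fun h => hp (le_zero_iff.1 (h ▸ hpq))
  have hpr : 0 < p.toReal := ENNReal.toReal_pos hp hp'
  have hqr : 0 < q.toReal := ENNReal.toReal_pos hq0 hq
  have hpqr : p.toReal ≤ q.toReal := ENNReal.toReal_mono hq hpq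
  rw [eLpNorm_eq_eLpNorm' hq0 hq, eLpNorm_eq_eLpNorm' hp hp', eLpNorm', eLpNorm',
    ← ENNReal.rpow_mul]
  have key : ∫⁻ x, ‖f x‖ₑ ^ q.toReal ∂μ ≤
      S ^ (q.toReal - p.toReal) * ∫⁻ x, ‖f x‖ₑ ^ p.toReal ∂μ := by
    rw [← lintegral_const_mul'' _ (hfm.enorm.pow_const _)]
    refine lintegral_mono fun x => ?_
    calc ‖f x‖ₑ ^ q.toReal = ‖f x‖ₑ ^ (q.toReal - p.toReal) * ‖f x‖ₑ ^ p.toReal := by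
          rw [← ENNReal.rpow_add_of_nonneg _ _ (by linarith) hpr.le, sub_add_cancel]
      _ ≤ _ := by
          gcongr
          exact hf x
  refine (ENNReal.rpow_le_rpow key (by positivity)).trans_eq ?_
  rw [ENNReal.mul_rpow_of_nonneg _ _ (by positivity), ← ENNReal.rpow_mul]
  congr 2 <;> field_simp

end Lp

section Young

variable {E F G : Type*} [NormedAddCommGroup E] [InnerProductSpace ℝ E] [FiniteDimensional ℝ E]
  [MeasurableSpace E] [BorelSpace E] [NormedAddCommGroup F] [NormedAddCommGroup G]

/-- **Young's inequality** `L¹ * L^p ⊆ L^p` for functions dominated by a convolution. -/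
theorem eLpNorm_le_of_enorm_le_lintegral_mul {g : E → ℝ≥0∞} (hg : Measurable g) {h : E → F}
    {f : E → G} (hf : Continuous f)
    (hle : ∀ x, ‖h x‖ₑ ≤ ∫⁻ t, g t * ‖f (x - t)‖ₑ) {p : ℝ≥0∞} (hp : 1 ≤ p) :
    eLpNorm h p volume ≤ (∫⁻ t, g t) * eLpNorm f p volume := by
  rcases eq_or_ne p ∞ with rfl | hp'
  · simp only [eLpNorm_exponent_top]
    refine eLpNormEssSup_le_of_ae_enorm_bound (.of_forall fun x => (hle x).trans ?_)
    rw [← lintegral_mul_const _ hg]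
    refine lintegral_mono_ae ?_
    filter_upwards [(quasiMeasurePreserving_sub_left volume x).ae
      (enorm_ae_le_eLpNormEssSup f volume)] with t ht
    gcongr
  have hp0 : p ≠ 0 := (zero_lt_one.trans_le hp).ne'
  have hp1 : 1 ≤ p.toReal := by simpa using ENNReal.toReal_mono hp' hp
  have hpr : 0 < p.toReal := by linarith
  have hfm : Measurable fun x => ‖f x‖ₑ := hf.enorm.measurable
  rw [eLpNorm_eq_eLpNorm' hp0 hp', eLpNorm_eq_eLpNorm' hp0 hp', eLpNorm', eLpNorm',
    one_div, ENNReal.rpow_inv_le_iff hpr, ENNReal.mul_rpow_of_nonneg _ _ hpr.le, ← ENNReal.rpow_mul,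
    inv_mul_cancel₀ hpr.ne', ENNReal.rpow_one]
  calc ∫⁻ x, ‖h x‖ₑ ^ p.toReal
      ≤ ∫⁻ x, (∫⁻ t, g t * ‖f (x - t)‖ₑ ^ p.toReal) * (∫⁻ t, g t) ^ (p.toReal - 1) := by
        refine lintegral_mono fun x => ?_
        have := (hle x).trans (lintegral_mul_le_rpow_mul_rpow hg.aemeasurable
          (hfm.comp (measurable_const.sub measurable_id)) hp1)
        refine (ENNReal.rpow_le_rpow this hpr.le).trans_eq ?_
        rw [ENNReal.mul_rpow_of_nonneg _ _ hpr.le, ← ENNReal.rpow_mul, ← ENNReal.rpow_mul,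
          one_div_mul_cancel hpr.ne', ENNReal.rpow_one, sub_mul,
          one_div_mul_cancel hpr.ne', one_mul]
        rfl
    _ = (∫⁻ t, g t) ^ p.toReal * ∫⁻ x, ‖f x‖ₑ ^ p.toReal := by
        have hm : Measurable (Function.uncurry fun x t => g t * ‖f (x - t)‖ₑ ^ p.toReal) :=
          (hg.comp measurable_snd).mul
            ((hfm.comp (measurable_fst.sub measurable_snd)).pow_const _)
        rw [lintegral_mul_const _ hm.lintegral_prod_right,
          lintegral_lintegral_swap hm.aemeasurable]
        have hft (t : E) : Measurable fun x => ‖f (x - t)‖ₑ ^ p.toReal :=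
          (hfm.comp (measurable_id.sub_const t)).pow_const _
        have (t : E) : ∫⁻ x, g t * ‖f (x - t)‖ₑ ^ p.toReal =
            g t * ∫⁻ x, ‖f x‖ₑ ^ p.toReal := by
          rw [lintegral_const_mul _ (hft t),
            lintegral_sub_right_eq_self (fun x => ‖f x‖ₑ ^ p.toReal)]
        simp_rw [this]
        rw [lintegral_mul_const _ hg, mul_right_comm]
        congr 1
        nth_rw 1 [← ENNReal.rpow_one (∫⁻ t, g t)]
        rw [← ENNReal.rpow_add_of_nonneg _ _ zero_le_one (by linarith), add_sub_cancel]

/-- `L^p → L^∞` bound for functions dominated by a convolution with a bounded integrable kernel. -/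
theorem enorm_le_of_enorm_le_lintegral_mul {g : E → ℝ≥0∞} (hg : Measurable g) {M : ℝ≥0∞}
    (hM : ∀ t, g t ≤ M) {h : E → F} {f : E → G} (hf : Continuous f)
    (hle : ∀ x, ‖h x‖ₑ ≤ ∫⁻ t, g t * ‖f (x - t)‖ₑ) {p : ℝ≥0∞} (hp : 1 ≤ p) (hp' : p ≠ ∞) (x : E) :
    ‖h x‖ₑ ≤ M ^ (1 / p.toReal) * (∫⁻ t, g t) ^ (1 - 1 / p.toReal) * eLpNorm f p volume := by
  have hp0 : p ≠ 0 := (zero_lt_one.trans_le hp).ne'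
  have hp1 : 1 ≤ p.toReal := by simpa using ENNReal.toReal_mono hp' hp
  have hpr : 0 < p.toReal := by linarith
  have hfm : Measurable fun x => ‖f x‖ₑ := hf.enorm.measurable
  refine ((hle x).trans (lintegral_mul_le_rpow_mul_rpow hg.aemeasurable
    (hfm.comp (measurable_const.sub measurable_id)) hp1)).trans ?_
  rw [eLpNorm_eq_eLpNorm' hp0 hp', eLpNorm', mul_right_comm,
    ← ENNReal.mul_rpow_of_nonneg _ _ (by positivity)]
  gcongr
  have hm : Measurable fun t => ‖f (x - t)‖ₑ ^ p.toReal :=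
    (hfm.comp (measurable_const.sub measurable_id)).pow_const _
  calc ∫⁻ t, g t * ‖f (x - t)‖ₑ ^ p.toReal
      ≤ ∫⁻ t, M * ‖f (x - t)‖ₑ ^ p.toReal := lintegral_mono fun t => by gcongr; exact hM t
    _ = M * ∫⁻ t, ‖f t‖ₑ ^ p.toReal := by
      rw [lintegral_const_mul _ hm, lintegral_sub_left_eq_self (fun t => ‖f t‖ₑ ^ p.toReal)]

end Young

section Kernel

variable {E : Type*} [NormedAddCommGroup E] [InnerProductSpace ℝ E] [FiniteDimensional ℝ E]
  [MeasurableSpace E] [BorelSpace E]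

open LineDeriv

theorem SchwartzMap.eq_convolution_of_fourier_eq_one {ψ w : 𝓢(E, ℂ)}
    (h : ∀ ξ, 𝓕 w ξ ≠ 0 → 𝓕 ψ ξ = 1) :
    w = convolution (ContinuousLinearMap.mul ℂ ℂ) ψ w := by
  apply (FourierTransform.fourierEquiv ℂ 𝓢(E, ℂ) (F := 𝓢(E, ℂ))).injective
  simp only [FourierTransform.fourierEquiv_apply, fourier_convolution]
  ext ξ
  by_cases hw : 𝓕 w ξ = 0
  · simp [pairing_apply_apply, hw]
  · simp [pairing_apply_apply, h ξ hw]

theorem SchwartzMap.fourier_lineDerivOp_apply (v : E) (w : 𝓢(E, ℂ)) (ξ : E) :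
    𝓕 (∂_{v} w) ξ = 2 * π * Complex.I * inner ℝ ξ v * 𝓕 w ξ := by
  have : (inner ℝ · v).HasTemperateGrowth := ((innerSL ℝ).flip v).hasTemperateGrowth
  simp [fourier_lineDerivOp_eq, this, mul_assoc]

theorem SchwartzMap.lineDerivOp_eq_convolution_of_fourier_eq_one {ψ w : 𝓢(E, ℂ)}
    (h : ∀ ξ, 𝓕 w ξ ≠ 0 → 𝓕 ψ ξ = 1) (v : E) :
    ∂_{v} w = convolution (ContinuousLinearMap.mul ℂ ℂ) (∂_{v} ψ) w := by
  apply (FourierTransform.fourierEquiv ℂ 𝓢(E, ℂ) (F := 𝓢(E, ℂ))).injective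
  simp only [FourierTransform.fourierEquiv_apply, fourier_convolution]
  ext ξ
  by_cases hw : 𝓕 w ξ = 0
  · simp [pairing_apply_apply, fourier_lineDerivOp_apply, hw]
  · simp [pairing_apply_apply, fourier_lineDerivOp_apply, h ξ hw]

theorem SchwartzMap.fourier_iteratedLineDerivOp_eq_zero {w : 𝓢(E, ℂ)} {ξ : E} (h : 𝓕 w ξ = 0)
    {n : ℕ} (m : Fin n → E) : 𝓕 (∂^{m} w) ξ = 0 := by
  induction n with
  | zero => simpa using h
  | succ n ih => rw [iteratedLineDerivOp_succ_left, fourier_lineDerivOp_apply, ih, mul_zero]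

theorem SchwartzMap.enorm_le_lintegral_of_fourier_eq_one {ψ u : 𝓢(E, ℂ)}
    (h : ∀ ξ, 𝓕 u ξ ≠ 0 → 𝓕 ψ ξ = 1) (x : E) :
    ‖u x‖ₑ ≤ ∫⁻ t, ‖ψ t‖ₑ * ‖u (x - t)‖ₑ := by
  conv_lhs => rw [eq_convolution_of_fourier_eq_one h, convolution_apply]
  refine (enorm_integral_le_lintegral_enorm _).trans_eq ?_
  simp [enorm_mul]

theorem SchwartzMap.enorm_iteratedFDeriv_succ_le_lintegral {ψ u : 𝓢(E, ℂ)}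
    (h : ∀ ξ, 𝓕 u ξ ≠ 0 → 𝓕 ψ ξ = 1) (k : ℕ) (x : E) :
    ‖iteratedFDeriv ℝ (k + 1) u x‖ₑ ≤
      ∫⁻ t, ‖fderiv ℝ ψ t‖ₑ * ‖iteratedFDeriv ℝ k u (x - t)‖ₑ := by
  set I := ∫⁻ t, ‖fderiv ℝ ψ t‖ₑ * ‖iteratedFDeriv ℝ k u (x - t)‖ₑ with hI
  rcases eq_or_ne I ∞ with htop | htop
  · simp [htop]
  rw [← ofReal_norm]
  refine ENNReal.ofReal_le_of_le_toReal
    (ContinuousMultilinearMap.opNorm_le_bound ENNReal.toReal_nonneg fun m => ?_)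
  have key : ‖iteratedFDeriv ℝ (k + 1) u x m‖ₑ ≤ I * ENNReal.ofReal (∏ i, ‖m i‖) := by
    rw [← iteratedLineDerivOp_eq_iteratedFDeriv, iteratedLineDerivOp_succ_left,
      lineDerivOp_eq_convolution_of_fourier_eq_one (ψ := ψ) fun ξ hξ => h ξ fun h0 =>
        hξ (fourier_iteratedLineDerivOp_eq_zero h0 _), convolution_apply, hI,
      ← lintegral_mul_const' _ _ ENNReal.ofReal_ne_top]
    refine (enorm_integral_le_lintegral_enorm _).trans (lintegral_mono fun t => ?_)
    simp only [ContinuousLinearMap.mul_apply', lineDerivOp_apply_eq_fderiv,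
      iteratedLineDerivOp_eq_iteratedFDeriv, ← ofReal_norm, norm_mul]
    rw [← ENNReal.ofReal_mul (by positivity), ← ENNReal.ofReal_mul (by positivity)]
    refine ENNReal.ofReal_le_ofReal ?_
    calc _ ≤ (‖fderiv ℝ ψ t‖ * ‖m 0‖) *
          (‖iteratedFDeriv ℝ k u (x - t)‖ * ∏ i, ‖Fin.tail m i‖) := by
          gcongr
          · exact ContinuousLinearMap.le_opNorm _ _
          · exact ContinuousMultilinearMap.le_opNorm _ _
      _ = _ := by rw [Fin.prod_univ_succ]; simp only [Fin.tail]; ring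
  rw [← toReal_enorm, ← ENNReal.toReal_ofReal (r := ∏ i, ‖m i‖) (by positivity),
    ← ENNReal.toReal_mul]
  exact ENNReal.toReal_mono (ENNReal.mul_ne_top htop ENNReal.ofReal_ne_top) key

theorem lintegral_pow_finrank_mul_comp_smul {r : ℝ} (hr : 0 < r) {f : E → ℝ≥0∞}
    (hf : Measurable f) :
    ∫⁻ x, ENNReal.ofReal (r ^ Module.finrank ℝ E) * f (r • x) = ∫⁻ x, f x := by
  rw [lintegral_const_mul' _ _ ENNReal.ofReal_ne_top, ← lintegral_map hf (measurable_const_smul r),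
    Measure.map_addHaar_smul _ hr.ne',
    lintegral_smul_measure, smul_eq_mul, ← mul_assoc, abs_of_pos (by positivity),
    ← ENNReal.ofReal_mul (by positivity), mul_inv_cancel₀ (by positivity)]
  simp

/-- Rescaled low-frequency kernels, with `L¹`, `L^∞` and gradient bounds. -/
theorem exists_schwartzMap_fourier_eq_one {R : ℝ} (hR : 0 < R) :
    ∃ C : ℝ, 1 ≤ C ∧ ∀ r : ℝ, 0 < r → ∃ ψ : 𝓢(E, ℂ),
      (∀ ξ ∈ Metric.closedBall (0 : E) (r * R), 𝓕 ψ ξ = 1) ∧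
      (∫⁻ x, ‖ψ x‖ₑ ≤ ENNReal.ofReal C) ∧
      (∀ x, ‖ψ x‖ₑ ≤ ENNReal.ofReal (C * r ^ Module.finrank ℝ E)) ∧
      (∫⁻ x, ‖fderiv ℝ ψ x‖ₑ ≤ ENNReal.ofReal (C * r)) := by
  let b : ContDiffBump (0 : E) := ⟨R, 2 * R, hR, by linarith⟩
  have hb : HasCompactSupport fun x => (b x : ℂ) :=
    b.hasCompactSupport.comp_left Complex.ofReal_zero
  let φ : 𝓢(E, ℂ) := 𝓕⁻ (hb.toSchwartzMap (Complex.ofRealCLM.contDiff.comp b.contDiff))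
  have hφ (ξ : E) : 𝓕 φ ξ = b ξ := by
    simp only [φ, FourierTransform.fourier_fourierInv_eq]
    rfl
  have hφ1 : ∫⁻ x, ‖φ x‖ₑ = ENNReal.ofReal (∫ x, ‖φ x‖) :=
    (ofReal_integral_norm_eq_lintegral_enorm φ.integrable).symm
  have hφ2 : ∫⁻ x, ‖fderiv ℝ φ x‖ₑ = ENNReal.ofReal (∫ x, ‖fderiv ℝ φ x‖) :=
    (ofReal_integral_norm_eq_lintegral_enorm (fderivCLM ℝ E ℂ φ).integrable).symm
  have hm : Measurable fun x => ‖φ x‖ₑ := φ.continuous.enorm.measurable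
  have hm' : Measurable fun x => ‖fderiv ℝ φ x‖ₑ :=
    (fderivCLM ℝ E ℂ φ).continuous.enorm.measurable
  have i1 : 0 ≤ ∫ x, ‖φ x‖ := by positivity
  have i2 : 0 ≤ ∫ x, ‖fderiv ℝ φ x‖ := by positivity
  have i3 : 0 ≤ SchwartzMap.seminorm ℝ 0 0 φ := apply_nonneg _ _
  refine ⟨1 + (∫ x, ‖φ x‖) + (∫ x, ‖fderiv ℝ φ x‖) + SchwartzMap.seminorm ℝ 0 0 φ,
    by linarith, fun r hr => ?_⟩
  set n := Module.finrank ℝ E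
  let ψ : 𝓢(E, ℂ) := r ^ n • compCLMOfContinuousLinearEquiv ℝ
    (ContinuousLinearEquiv.smulLeft (Units.mk0 r hr.ne')) φ
  have hψ : ⇑ψ = fun x => r ^ n • φ (r • x) := by ext x; simp [ψ, Units.smul_def]
  have hψ' (x : E) : fderiv ℝ ψ x = r ^ n • r • fderiv ℝ φ (r • x) := by
    rw [hψ, fderiv_fun_const_smul, fderiv_comp_smul]
    exact φ.differentiable.comp (differentiable_id.const_smul r) x
  refine ⟨ψ, fun ξ hξ => ?_, ?_, fun x => ?_, ?_⟩
  · have : 𝓕 ψ ξ = 𝓕 φ (r⁻¹ • ξ) := by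
      rw [fourier_coe, fourier_coe, Real.fourier_eq, Real.fourier_eq, hψ]
      have (v : E) : 𝐞 (-inner ℝ v ξ) • r ^ n • φ (r • v) =
          r ^ n • (fun y => 𝐞 (-inner ℝ y (r⁻¹ • ξ)) • φ y) (r • v) := by
        simp only [inner_smul_left, inner_smul_right, conj_trivial]
        rw [inv_mul_cancel_left₀ hr.ne', smul_comm]
      rw [integral_congr_ae (.of_forall this), integral_smul,
        Measure.integral_comp_smul_of_nonneg volume
          (fun y => 𝐞 (-inner ℝ y (r⁻¹ • ξ)) • φ y) r (hR := hr.le), smul_smul,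
        mul_inv_cancel₀ (by positivity), one_smul]
    rw [this, hφ, b.one_of_mem_closedBall, Complex.ofReal_one]
    rw [mem_closedBall_zero_iff] at hξ ⊢
    rw [norm_smul, norm_inv, norm_eq_abs, abs_of_pos hr, inv_mul_le_iff₀ hr]
    exact hξ
  · simp_rw [hψ, enorm_smul, Real.enorm_of_nonneg (pow_nonneg hr.le n)]
    rw [lintegral_pow_finrank_mul_comp_smul hr hm, hφ1]
    exact ENNReal.ofReal_le_ofReal (by linarith)
  · rw [← ofReal_norm]
    refine ENNReal.ofReal_le_ofReal ?_
    rw [hψ, norm_smul, norm_of_nonneg (by positivity), mul_comm]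
    gcongr
    linarith [norm_le_seminorm ℝ φ (r • x)]
  · simp_rw [hψ', enorm_smul, Real.enorm_of_nonneg (pow_nonneg hr.le n)]
    rw [lintegral_pow_finrank_mul_comp_smul hr (hm'.const_mul ‖r‖ₑ), lintegral_const_mul _ hm',
      hφ2, Real.enorm_of_nonneg hr.le, ← ENNReal.ofReal_mul hr.le, mul_comm]
    refine ENNReal.ofReal_le_ofReal ?_
    gcongr
    linarith

end Kernel

section Bernstein

variable {E : Type*} [NormedAddCommGroup E] [InnerProductSpace ℝ E] [FiniteDimensional ℝ E]
  [MeasurableSpace E] [BorelSpace E]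

theorem eLpNorm_iteratedFDeriv_le_pow_mul_eLpNorm {ψ u : 𝓢(E, ℂ)}
    (h : ∀ ξ, 𝓕 u ξ ≠ 0 → 𝓕 ψ ξ = 1) {q : ℝ≥0∞} (hq : 1 ≤ q) (k : ℕ) :
    eLpNorm (iteratedFDeriv ℝ k u) q volume ≤
      (∫⁻ x, ‖fderiv ℝ ψ x‖ₑ) ^ k * eLpNorm u q volume := by
  induction k with
  | zero =>
    rw [pow_zero, one_mul]
    exact (eLpNorm_congr_norm_ae (.of_forall fun x => norm_iteratedFDeriv_zero)).le
  | succ k ih =>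
    have hg : Measurable fun x => ‖fderiv ℝ ψ x‖ₑ :=
      (fderivCLM ℝ E ℂ ψ).continuous.enorm.measurable
    have hf : Continuous (iteratedFDeriv ℝ k u) :=
      (u.smooth ⊤).continuous_iteratedFDeriv (mod_cast le_top)
    refine (eLpNorm_le_of_enorm_le_lintegral_mul hg hf
      (enorm_iteratedFDeriv_succ_le_lintegral h k) hq).trans ?_
    rw [pow_succ', mul_assoc]
    gcongr

theorem eLpNorm_le_rpow_mul_eLpNorm_of_fourier_eq_one {ψ u : 𝓢(E, ℂ)}
    (h : ∀ ξ, 𝓕 u ξ ≠ 0 → 𝓕 ψ ξ = 1) {C L : ℝ} (hC : 1 ≤ C) (hL : 0 < L)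
    (h1 : ∫⁻ x, ‖ψ x‖ₑ ≤ ENNReal.ofReal C) (hM : ∀ x, ‖ψ x‖ₑ ≤ ENNReal.ofReal (C * L))
    {p q : ℝ≥0∞} (hp : 1 ≤ p) (hpq : p ≤ q) :
    eLpNorm u q volume ≤
      ENNReal.ofReal (C * L ^ (p⁻¹.toReal - q⁻¹.toReal)) * eLpNorm u p volume := by
  rcases eq_or_ne p ∞ with rfl | hp'
  · obtain rfl := top_le_iff.1 hpq
    simpa using le_mul_of_one_le_left zero_le (ENNReal.one_le_ofReal.2 hC)
  have hC0 : 0 < C := by linarith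
  have hp1 : 1 ≤ p.toReal := by simpa using ENNReal.toReal_mono hp' hp
  have hpr : 0 < p.toReal := by linarith
  have hsup (x : E) : ‖u x‖ₑ ≤
      ENNReal.ofReal (C * L ^ (1 / p.toReal)) * eLpNorm u p volume := by
    refine (enorm_le_of_enorm_le_lintegral_mul ψ.continuous.enorm.measurable hM u.continuous
      (enorm_le_lintegral_of_fourier_eq_one h) hp hp' x).trans ?_
    have hs : 0 ≤ 1 - 1 / p.toReal := sub_nonneg.2 ((div_le_one hpr).2 hp1)
    calc _ ≤ ENNReal.ofReal (C * L) ^ (1 / p.toReal) * ENNReal.ofReal C ^ (1 - 1 / p.toReal) *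
          eLpNorm u p volume := by gcongr
      _ = _ := by
          rw [ENNReal.ofReal_rpow_of_pos (by positivity), ENNReal.ofReal_rpow_of_pos hC0,
            ← ENNReal.ofReal_mul (by positivity), Real.mul_rpow hC0.le hL.le, mul_right_comm,
            ← Real.rpow_add hC0, add_sub_cancel, Real.rpow_one]
  rcases eq_or_ne q ∞ with rfl | hq
  · simpa [eLpNorm_exponent_top] using
      eLpNormEssSup_le_of_ae_enorm_bound (.of_forall hsup) (μ := volume)
  have hpqr : p.toReal ≤ q.toReal := ENNReal.toReal_mono hq hpq
  have hqr : 0 < q.toReal := by linarith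
  have hs : 0 ≤ 1 - p.toReal / q.toReal := sub_nonneg.2 ((div_le_one hqr).2 hpqr)
  refine (eLpNorm_le_rpow_mul_eLpNorm_rpow u.continuous.aestronglyMeasurable hsup
    (zero_lt_one.trans_le hp).ne' hpq hq).trans ?_
  rw [ENNReal.mul_rpow_of_nonneg _ _ hs, mul_assoc,
    ← ENNReal.rpow_add_of_nonneg _ _ hs (by positivity), sub_add_cancel, ENNReal.rpow_one,
    ENNReal.ofReal_rpow_of_pos (by positivity), Real.mul_rpow hC0.le (by positivity),
    ← Real.rpow_mul hL.le]
  have he : 1 / p.toReal * (1 - p.toReal / q.toReal) = p⁻¹.toReal - q⁻¹.toReal := by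
    rw [ENNReal.toReal_inv, ENNReal.toReal_inv]
    field_simp
  rw [he]
  gcongr
  exact (Real.rpow_le_rpow_of_exponent_le hC (sub_le_self _ (by positivity))).trans_eq
    (Real.rpow_one C)

end Bernstein

/-- **Bernstein's first inequality.** If the Fourier transform of a Schwartz function
`u : ℝ^d → ℂ` is supported in the closed ball of radius `λ R`, then
`‖∇^k u‖_{L^q} ≤ C^{k+1} λ^{k + d(1/p - 1/q)} ‖u‖_{L^p}` for all `1 ≤ p ≤ q ≤ ∞`. -/
theorem bernstein_ball (d : ℕ) (hd : 1 ≤ d) (R : ℝ) (hR : 0 < R) :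
    ∃ C > 0, ∀ (k : ℕ) (p q : ℝ≥0∞), 1 ≤ p → p ≤ q → ∀ lam : ℝ, 0 < lam →
      ∀ u : SchwartzMap (EuclideanSpace ℝ (Fin d)) ℂ,
        (Function.support (𝓕 ⇑u) ⊆ Metric.closedBall 0 (lam * R)) →
        eLpNorm (iteratedFDeriv ℝ k ⇑u) q volume ≤
          ENNReal.ofReal (C ^ (k + 1) *
              lam ^ ((k : ℝ) + d * (p⁻¹.toReal - q⁻¹.toReal))) *
            eLpNorm (⇑u) p volume := by
  obtain ⟨C, hC1, hC⟩ := exists_schwartzMap_fourier_eq_one (E := EuclideanSpace ℝ (Fin d)) hR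
  have hC0 : 0 < C := by linarith
  refine ⟨C, hC0, fun k p q hp hpq lam hlam u hu => ?_⟩
  obtain ⟨ψ, hψ, hψ1, hψM, hψD⟩ := hC lam hlam
  have hu' (ξ) (hξ : 𝓕 u ξ ≠ 0) : 𝓕 ψ ξ = 1 := hψ ξ (hu (by rwa [fourier_coe] at hξ))
  rw [finrank_euclideanSpace_fin] at hψM
  have h1 := eLpNorm_iteratedFDeriv_le_pow_mul_eLpNorm hu' (hp.trans hpq) k
  have h2 := eLpNorm_le_rpow_mul_eLpNorm_of_fourier_eq_one hu' hC1 (pow_pos hlam d) hψ1 hψM hp hpq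
  calc eLpNorm (iteratedFDeriv ℝ k ⇑u) q volume
      ≤ ENNReal.ofReal (C * lam) ^ k * (ENNReal.ofReal
          (C * (lam ^ d) ^ (p⁻¹.toReal - q⁻¹.toReal)) * eLpNorm u p volume) := by
        refine h1.trans ?_
        gcongr
    _ = _ := by
        rw [← mul_assoc, ← ENNReal.ofReal_pow (by positivity),
          ← ENNReal.ofReal_mul (by positivity), Real.rpow_add hlam, Real.rpow_natCast,
          Real.rpow_mul hlam.le, Real.rpow_natCast]
        ring_nf
end

section
/- Let d ≥ 1, let m ∈ ℤ, and let σ : ℝ^d \ {0} → ℂ be a smooth function which is homogeneous of degree m, i.e. σ(tξ) = t^m σ(ξ) for all t > 0 and ξ ≠ 0. Let 0 < r < R. Then there exists a constant C > 0 such that for every integer j ≥ 0, every exponent 1 ≤ p ≤ ∞, and every Schwartz function u : ℝ^d → ℂ whose Fourier transform û is supported in the annulus {ξ : 2^j r ≤ |ξ| ≤ 2^j R}, one has ‖F^{−1}(σ · û)‖_{L^p} ≤ C · 2^{jm} · ‖u‖_{L^p}. -/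
open MeasureTheory SchwartzMap Real
open scoped ENNReal FourierTransform

/-- A continuous function is bounded everywhere by its essential supremum. -/
lemma enorm_le_eLpNorm_top_of_continuous {X : Type*} [TopologicalSpace X]
    [MeasurableSpace X] {μ : Measure X} [μ.IsOpenPosMeasure] {g : X → ℂ} (hg : Continuous g) (x : X) :
    ‖g x‖ₑ ≤ eLpNorm g ∞ μ := by
  have hdense : Dense {y | ‖g y‖ₑ ≤ eLpNorm g ∞ μ} :=
    Measure.dense_of_ae (by simpa using ae_le_eLpNormEssSup (f := g) (μ := μ))
  have hclosed : IsClosed {y | ‖g y‖ₑ ≤ eLpNorm g ∞ μ} :=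
    isClosed_le hg.enorm continuous_const
  have hx : x ∈ closure {y | ‖g y‖ₑ ≤ eLpNorm g ∞ μ} := hdense x
  rwa [hclosed.closure_eq] at hx

section Young

variable {E : Type*} [NormedAddCommGroup E] [NormedSpace ℝ E] [FiniteDimensional ℝ E]
  [MeasurableSpace E] [BorelSpace E] {μ : Measure E} [μ.IsAddHaarMeasure]

/-- Averaging translates of `g` against a finite measure `ν` is bounded on `L^p`,
with constant the mass of `ν`. -/
lemma lintegral_lintegral_translate_rpow_le (ν : Measure E) [IsFiniteMeasure ν] {g : E → ℂ}
    (hg : Continuous g) (a : ℝ) {p : ℝ≥0∞} (hp : 1 ≤ p) (hp_top : p ≠ ∞) :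
    ∫⁻ x, (∫⁻ y, ‖g (x - a • y)‖ₑ ∂ν) ^ p.toReal ∂μ ≤
      (ν Set.univ * eLpNorm g p μ) ^ p.toReal := by
  have hp0 : p ≠ 0 := (zero_lt_one.trans_le hp).ne'
  have hp_pos : 0 < p.toReal := ENNReal.toReal_pos hp0 hp_top
  have hp_one : 1 ≤ p.toReal := by
    simpa using ENNReal.toReal_mono hp_top hp
  have hpow (f : E → ℂ) (κ : Measure E) :
      eLpNorm f p κ ^ p.toReal = ∫⁻ y, ‖f y‖ₑ ^ p.toReal ∂κ := by
    rw [eLpNorm_eq_lintegral_rpow_enorm_toReal hp0 hp_top, ← ENNReal.rpow_mul,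
      one_div_mul_cancel hp_pos.ne', ENNReal.rpow_one]
  have hpointwise (x : E) : (∫⁻ y, ‖g (x - a • y)‖ₑ ∂ν) ^ p.toReal ≤
      (∫⁻ y, ‖g (x - a • y)‖ₑ ^ p.toReal ∂ν) * ν Set.univ ^ (p.toReal - 1) := by
    have hcont : Continuous fun y => g (x - a • y) := by fun_prop
    have h := eLpNorm_le_eLpNorm_mul_rpow_measure_univ (μ := ν) hp hcont.aestronglyMeasurable
    rw [eLpNorm_one_eq_lintegral_enorm] at h
    refine (ENNReal.rpow_le_rpow h hp_pos.le).trans_eq ?_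
    rw [ENNReal.mul_rpow_of_nonneg _ _ hp_pos.le, hpow, ← ENNReal.rpow_mul]
    congr 2
    simp only [ENNReal.toReal_one]
    field_simp
  have hmeas : Measurable (Function.uncurry fun x y : E => ‖g (x - a • y)‖ₑ ^ p.toReal) := by
    have : Continuous fun z : E × E => g (z.1 - a • z.2) := by fun_prop
    exact this.enorm.measurable.pow_const _
  calc
    ∫⁻ x, (∫⁻ y, ‖g (x - a • y)‖ₑ ∂ν) ^ p.toReal ∂μ
      ≤ ∫⁻ x, (∫⁻ y, ‖g (x - a • y)‖ₑ ^ p.toReal ∂ν) * ν Set.univ ^ (p.toReal - 1) ∂μ :=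
        lintegral_mono hpointwise
    _ = (∫⁻ x, ∫⁻ y, ‖g (x - a • y)‖ₑ ^ p.toReal ∂ν ∂μ) * ν Set.univ ^ (p.toReal - 1) :=
        lintegral_mul_const _ hmeas.lintegral_prod_right
    _ = (∫⁻ y, ∫⁻ x, ‖g (x - a • y)‖ₑ ^ p.toReal ∂μ ∂ν) * ν Set.univ ^ (p.toReal - 1) := by
        rw [lintegral_lintegral_swap hmeas.aemeasurable]
    _ = (ν Set.univ * eLpNorm g p μ) ^ p.toReal := by
        have htrans (y : E) : ∫⁻ x, ‖g (x - a • y)‖ₑ ^ p.toReal ∂μ = eLpNorm g p μ ^ p.toReal := by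
          rw [hpow, lintegral_sub_right_eq_self (fun x => ‖g x‖ₑ ^ p.toReal) (a • y)]
        have hmass : ν Set.univ * ν Set.univ ^ (p.toReal - 1) = ν Set.univ ^ p.toReal := by
          conv_lhs => enter [1]; rw [← ENNReal.rpow_one (ν Set.univ)]
          rw [← ENNReal.rpow_add_of_nonneg _ _ zero_le_one (by linarith)]
          ring_nf
        simp only [htrans, lintegral_const]
        rw [mul_assoc, hmass, ENNReal.mul_rpow_of_nonneg _ _ hp_pos.le, mul_comm]

/-- Young's inequality `L¹ * L^p → L^p` for a convolution with dilated translations. -/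
lemma eLpNorm_integral_mul_translate_le {k g : E → ℂ} (hk : Integrable k μ) (hkc : Continuous k)
    (hg : Continuous g) (a : ℝ) {p : ℝ≥0∞} (hp : 1 ≤ p) :
    eLpNorm (fun x => ∫ y, k y * g (x - a • y) ∂μ) p μ ≤ eLpNorm k 1 μ * eLpNorm g p μ := by
  set ν : Measure E := μ.withDensity fun y => ‖k y‖ₑ with hν
  have hmass : ν Set.univ = eLpNorm k 1 μ := by
    rw [hν, withDensity_apply _ MeasurableSet.univ, setLIntegral_univ,
      eLpNorm_one_eq_lintegral_enorm]
  have : IsFiniteMeasure ν := ⟨by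
    rw [hmass]
    exact (memLp_one_iff_integrable.2 hk).eLpNorm_lt_top⟩
  have hbound (x : E) : ‖∫ y, k y * g (x - a • y) ∂μ‖ₑ ≤ ∫⁻ y, ‖g (x - a • y)‖ₑ ∂ν := by
    have hcont : Continuous fun y => g (x - a • y) := by fun_prop
    refine (enorm_integral_le_lintegral_enorm _).trans_eq ?_
    rw [hν, lintegral_withDensity_eq_lintegral_mul _ hkc.enorm.measurable hcont.enorm.measurable]
    simp [enorm_mul]
  rw [← hmass]
  rcases eq_or_ne p ∞ with rfl | hp_top
  · rw [eLpNorm_exponent_top]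
    refine eLpNormEssSup_le_of_ae_enorm_bound (ae_of_all _ fun x => (hbound x).trans ?_)
    refine (lintegral_mono fun y =>
      enorm_le_eLpNorm_top_of_continuous (μ := μ) hg (x - a • y)).trans_eq ?_
    rw [lintegral_const, mul_comm, eLpNorm_exponent_top]
  · have hp0 : p ≠ 0 := (zero_lt_one.trans_le hp).ne'
    have hp_pos : 0 < p.toReal := ENNReal.toReal_pos hp0 hp_top
    rw [eLpNorm_eq_lintegral_rpow_enorm_toReal hp0 hp_top, one_div,
      ENNReal.rpow_inv_le_iff hp_pos]
    exact (lintegral_mono fun x => ENNReal.rpow_le_rpow (hbound x) hp_pos.le).trans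
      (lintegral_lintegral_translate_rpow_le ν hg a hp hp_top)

end Young

section Multiplier

variable {V : Type*} [NormedAddCommGroup V] [InnerProductSpace ℝ V] [FiniteDimensional ℝ V]
  [MeasurableSpace V] [BorelSpace V]

/-- A Fourier multiplier with dilated symbol `𝓕 k (a • ·)` is convolution against the
correspondingly dilated kernel. -/
lemma fourierInv_fourier_smul_mul_fourier (k u : 𝓢(V, ℂ)) (a : ℝ) (x : V) :
    𝓕⁻ (fun ξ => 𝓕 (⇑k) (a • ξ) * 𝓕 (⇑u) ξ) x = ∫ y, k y * u (x - a • y) := by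
  have hint : Integrable fun ξ => 𝐞 (inner ℝ ξ x) • 𝓕 (⇑u) ξ := by
    have h : Integrable (𝓕 (⇑u)) := by
      rw [← fourier_coe]
      exact (𝓕 u).integrable
    have hflip := (VectorFourier.fourierIntegral_convergent_iff (μ := volume) (e := 𝐞)
      (L := innerₗ V) Real.continuous_fourierChar continuous_inner (-x)).2 h
    simpa using hflip
  have hL : Continuous fun q : V × V => (a • innerₗ V) q.1 q.2 := by
    simp only [LinearMap.smul_apply, innerₗ_apply_apply]
    fun_prop
  have hswap := VectorFourier.integral_fourierIntegral_smul_eq_flip (μ := volume) (ν := volume)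
    (L := a • innerₗ V) Real.continuous_fourierChar hL k.integrable hint
  have hinv (z : V) : ∫ ξ, 𝐞 (inner ℝ ξ z) • 𝓕 (⇑u) ξ = u z := by
    rw [← Real.fourierInv_eq, ← fourier_coe, ← fourierInv_coe,
      FourierTransform.fourierInv_fourier_eq]
  rw [Real.fourierInv_eq]
  calc
    ∫ ξ, 𝐞 (inner ℝ ξ x) • (𝓕 (⇑k) (a • ξ) * 𝓕 (⇑u) ξ)
      = ∫ ξ, VectorFourier.fourierIntegral 𝐞 volume (a • innerₗ V) k ξ •
          (𝐞 (inner ℝ ξ x) • 𝓕 (⇑u) ξ) := by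
        congr with ξ
        have : VectorFourier.fourierIntegral 𝐞 volume (a • innerₗ V) k ξ = 𝓕 (⇑k) (a • ξ) := by
          simp [VectorFourier.fourierIntegral, Real.fourier_eq, inner_smul_right]
        rw [this, smul_eq_mul, mul_smul_comm]
    _ = ∫ y, k y • VectorFourier.fourierIntegral 𝐞 volume (a • innerₗ V).flip
          (fun ξ => 𝐞 (inner ℝ ξ x) • 𝓕 (⇑u) ξ) y := hswap
    _ = ∫ y, k y * u (x - a • y) := by
        congr with y
        rw [← hinv (x - a • y), smul_eq_mul]
        congr 1
        refine integral_congr_ae (ae_of_all _ fun ξ => ?_)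
        simp only [LinearMap.flip_apply, LinearMap.smul_apply, innerₗ_apply_apply, smul_smul]
        rw [← AddChar.map_add_eq_mul, inner_sub_right, inner_smul_right, real_inner_comm]
        congr 2
        simp [smul_eq_mul]
        ring

end Multiplier

/-- A function smooth away from the origin agrees, on an annulus, with a Schwartz function. -/
lemma exists_schwartzMap_eq_on_annulus {V : Type*} [NormedAddCommGroup V]
    [InnerProductSpace ℝ V] [FiniteDimensional ℝ V] {σ : V → ℂ}
    (hσ : ContDiffOn ℝ (⊤ : ℕ∞) σ {(0 : V)}ᶜ) {r R : ℝ} (hr : 0 < r) (hrR : r < R) :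
    ∃ ψ : 𝓢(V, ℂ), ∀ ξ, r ≤ ‖ξ‖ → ‖ξ‖ ≤ R → ψ ξ = σ ξ := by
  let f : ContDiffBump (0 : V) := ⟨R, R + 1, hr.trans hrR, by linarith⟩
  let g : ContDiffBump (0 : V) := ⟨r / 2, r, by linarith, by linarith⟩
  let φ : V → ℂ := fun ξ => ((f ξ * (1 - g ξ) : ℝ) : ℂ) * σ ξ
  have hcompact : HasCompactSupport φ := by
    refine f.hasCompactSupport.mono' fun ξ hξ => subset_tsupport _ fun h0 => hξ ?_
    simp [φ, h0]
  have hsmooth : ContDiff ℝ (⊤ : ℕ∞) φ := by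
    rw [contDiff_iff_contDiffAt]
    intro ξ
    by_cases hξ : ξ = 0
    · subst hξ
      have hzero : φ =ᶠ[nhds 0] fun _ => 0 := by
        filter_upwards [g.eventuallyEq_one] with ξ h1
        simp only [Pi.one_apply] at h1
        simp [φ, h1]
      exact contDiffAt_const.congr_of_eventuallyEq hzero
    · have hcut : ContDiff ℝ (⊤ : ℕ∞) fun ξ => ((f ξ * (1 - g ξ) : ℝ) : ℂ) :=
        Complex.ofRealCLM.contDiff.comp (f.contDiff.mul (contDiff_const.sub g.contDiff))
      exact hcut.contDiffAt.mul (hσ.contDiffAt (isOpen_compl_singleton.mem_nhds hξ))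
  refine ⟨hcompact.toSchwartzMap hsmooth, fun ξ hrξ hξR => ?_⟩
  have hf : f ξ = 1 := f.one_of_mem_closedBall (by simpa using hξR)
  have hg : g ξ = 0 := g.zero_of_le_dist (by simpa using hrξ)
  simp [φ, hf, hg]

/-- **`L^p` boundedness of smooth homogeneous Fourier multipliers on spectrally
localized functions.** If `σ` is smooth away from the origin and homogeneous of degree
`m ∈ ℤ`, and `û` is supported in the annulus `{ξ : 2^j r ≤ |ξ| ≤ 2^j R}`, then
`‖F⁻¹(σ·û)‖_{L^p} ≤ C 2^{jm} ‖u‖_{L^p}`. -/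
theorem multiplier_homogeneous_bound (d : ℕ) (hd : 1 ≤ d) (m : ℤ)
    (σ : EuclideanSpace ℝ (Fin d) → ℂ)
    (hσ_smooth : ContDiffOn ℝ (⊤ : ℕ∞) σ {(0 : EuclideanSpace ℝ (Fin d))}ᶜ)
    (hσ_hom : ∀ t : ℝ, 0 < t → ∀ ξ : EuclideanSpace ℝ (Fin d), ξ ≠ 0 →
      σ (t • ξ) = ((t ^ m : ℝ) : ℂ) * σ ξ)
    (r R : ℝ) (hr : 0 < r) (hrR : r < R) :
    ∃ C > 0, ∀ (j : ℕ) (p : ℝ≥0∞), 1 ≤ p →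
      ∀ u : SchwartzMap (EuclideanSpace ℝ (Fin d)) ℂ,
        (Function.support (𝓕 ⇑u) ⊆ {ξ | 2 ^ j * r ≤ ‖ξ‖ ∧ ‖ξ‖ ≤ 2 ^ j * R}) →
        eLpNorm (𝓕⁻ fun ξ => σ ξ * 𝓕 (⇑u) ξ) p volume ≤
          ENNReal.ofReal (C * (2 : ℝ) ^ ((j : ℤ) * m)) * eLpNorm (⇑u) p volume := by
  obtain ⟨ψ, hψ⟩ := exists_schwartzMap_eq_on_annulus hσ_smooth hr hrR
  set k := 𝓕⁻ ψ with hk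
  have hk_fin : eLpNorm (⇑k) 1 volume ≠ ∞ :=
    (memLp_one_iff_integrable.2 k.integrable).eLpNorm_lt_top.ne
  refine ⟨(eLpNorm (⇑k) 1 volume).toReal + 1, by positivity, fun j p hp u hu => ?_⟩
  have hj : (0 : ℝ) < 2 ^ j := by positivity
  set a : ℝ := ((2 : ℝ) ^ j)⁻¹ with ha
  have hscale : ((2 : ℝ) ^ j) ^ m = 2 ^ ((j : ℤ) * m) := by
    rw [zpow_mul, zpow_natCast]
  have hsymbol : (fun ξ => σ ξ * 𝓕 (⇑u) ξ) =
      fun ξ => (((2 : ℝ) ^ ((j : ℤ) * m) : ℝ) : ℂ) • (𝓕 (⇑k) (a • ξ) * 𝓕 (⇑u) ξ) := by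
    ext ξ
    by_cases hξ : 𝓕 (⇑u) ξ = 0
    · simp [hξ]
    obtain ⟨hlow, hupp⟩ := hu hξ
    have hnorm : ‖a • ξ‖ = ‖ξ‖ / 2 ^ j := by
      rw [norm_smul, Real.norm_of_nonneg (by positivity), ha, div_eq_inv_mul]
    have hlow' : r ≤ ‖a • ξ‖ := by
      rw [hnorm, le_div_iff₀ hj]
      linarith
    have hupp' : ‖a • ξ‖ ≤ R := by
      rw [hnorm, div_le_iff₀ hj]
      linarith
    have hne : a • ξ ≠ 0 := norm_pos_iff.1 (hr.trans_le hlow')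
    have hσξ : σ ξ = (((2 : ℝ) ^ ((j : ℤ) * m) : ℝ) : ℂ) * σ (a • ξ) := by
      rw [← hscale, ← hσ_hom _ hj _ hne, smul_smul, ha, mul_inv_cancel₀ hj.ne', one_smul]
    have hkψ : 𝓕 (⇑k) = ⇑ψ := by
      rw [← fourier_coe, hk, FourierTransform.fourier_fourierInv_eq]
    rw [hkψ, hψ _ hlow' hupp', hσξ, smul_eq_mul, mul_assoc]
  have hkernel : 𝓕⁻ (fun ξ => σ ξ * 𝓕 (⇑u) ξ) =
      (((2 : ℝ) ^ ((j : ℤ) * m) : ℝ) : ℂ) • fun x => ∫ y, k y * u (x - a • y) := by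
    ext x
    rw [hsymbol, Pi.smul_apply, ← fourierInv_fourier_smul_mul_fourier, Real.fourierInv_eq,
      Real.fourierInv_eq, ← integral_smul]
    exact integral_congr_ae (ae_of_all _ fun ξ => smul_comm _ _ _)
  have hpow : (0 : ℝ) < 2 ^ ((j : ℤ) * m) := by positivity
  rw [hkernel, eLpNorm_const_smul]
  calc
    _ ≤ ENNReal.ofReal (2 ^ ((j : ℤ) * m)) *
          (eLpNorm (⇑k) 1 volume * eLpNorm (⇑u) p volume) := by
        gcongr
        · rw [← ofReal_norm, Complex.norm_real, Real.norm_of_nonneg hpow.le]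
        · exact eLpNorm_integral_mul_translate_le k.integrable k.continuous u.continuous a hp
    _ ≤ _ := by
        rw [← mul_assoc]
        gcongr
        rw [mul_comm, ENNReal.ofReal_mul (by positivity)]
        gcongr
        rw [← ENNReal.ofReal_toReal hk_fin]
        exact ENNReal.ofReal_le_ofReal (by simp)
end
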